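/- Let σ and τ be permutations of a finite set I. For each orbit c of the subgroup ⟨σ,τ⟩ on I, define the graph defect gd(σ,τ)_c = (1/2)(|c| + 2 − |c/⟨σ⟩| − |c/⟨τ⟩| − |c/⟨στ⟩|), where |c/⟨π⟩| denotes the number of orbits of ⟨π⟩ contained in c. Then gd(σ,τ)_c is a non-negative integer. -/

import Mathlib

open Equiv in
theorem gd_perm_ind {α : Type*} [Fintype α] [DecidableEq α] {P : Perm α → Prop} (h1 : P 1)
    (h2 : ∀ (f : Perm α) (x y : α), x ≠ y → f x = x → P f → P (swap x y * f)) (f : Perm α) : P f := by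
  induction hn : f.support.card using Nat.strong_induction_on generalizing f with
  | _ n ih =>
    by_cases hf : f = 1
    · rw [hf]; exact h1
    · obtain ⟨x, hx⟩ : ∃ x, f x ≠ x := by
        by_contra! h
        exact hf (Equiv.ext h)
      have hlt := Equiv.Perm.card_support_swap_mul hx
      have := h2 (swap x (f x) * f) x (f x) (Ne.symm hx) (by simp)
        (ih _ (hn ▸ hlt) _ rfl)
      rwa [← mul_assoc, Equiv.swap_mul_self, one_mul] at this

/-- the setoid identifying only `x` and `y` -/
def gdPair {α : Type*} (x y : α) : Setoid α := Relation.EqvGen.setoid (fun a b => a = x ∧ b = y)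

theorem gdPair_le {α : Type*} {x y : α} {r : Setoid α} : gdPair x y ≤ r ↔ r x y := by
  constructor
  · intro h
    exact h (Relation.EqvGen.rel _ _ ⟨rfl, rfl⟩)
  · intro h
    apply Setoid.eqvGen_le
    rintro a b ⟨rfl, rfl⟩
    exact h

/-- number of classes -/
noncomputable def gdN {α : Type*} (r : Setoid α) : ℕ := Nat.card (Quotient r)

theorem gdN_pair_of {α : Type*} {x y : α} {r : Setoid α} (h : r x y) :
    gdN (r ⊔ gdPair x y) = gdN r := by
  rw [sup_eq_left.2 (gdPair_le.2 h)]

theorem gdN_pair_not {α : Type*} [Fintype α] {x y : α} {r : Setoid α} (h : ¬ r x y) :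
    gdN (r ⊔ gdPair x y) + 1 = gdN r := by
  classical
  -- explicit merged map
  let g : α → Quotient r := fun a => if r a y then ⟦x⟧ else ⟦a⟧
  have hg : Setoid.ker g = r ⊔ gdPair x y := by
    apply le_antisymm
    · intro a b hab
      have key : ∀ a, ∃ a', g a = ⟦a'⟧ ∧ (r ⊔ gdPair x y) a a' := by
        intro a
        by_cases ha : r a y
        · refine ⟨x, by simp [g, ha], ?_⟩
          have h1 : (r ⊔ gdPair x y) a y := (le_sup_left : r ≤ r ⊔ gdPair x y) ha
          have h2 : (r ⊔ gdPair x y) x y := gdPair_le.1 le_sup_right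
          exact Setoid.trans' _ h1 (Setoid.symm' _ h2)
        · exact ⟨a, by simp [g, ha], Setoid.refl' _ a⟩
      obtain ⟨a', ha, ha'⟩ := key a
      obtain ⟨b', hb, hb'⟩ := key b
      have hab' : g a = g b := hab
      rw [ha, hb] at hab'
      have h3 : r a' b' := Quotient.exact hab'
      have h4 : (r ⊔ gdPair x y) a' b' := (le_sup_left : r ≤ r ⊔ gdPair x y) h3
      exact Setoid.trans' _ ha' (Setoid.trans' _ h4 (Setoid.symm' _ hb'))
    · apply sup_le
      · intro a b hab
        change g a = g b
        have : r a y ↔ r b y :=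
          ⟨fun h => Setoid.trans' _ (Setoid.symm' _ hab) h, fun h => Setoid.trans' _ hab h⟩
        by_cases hb : r b y
        · simp [g, hb, this.2 hb]
        · have ha : ¬ r a y := fun h => hb (this.1 h)
          simp only [g, hb, ha, if_false]
          exact Quotient.sound hab
      · rw [gdPair_le]
        change g x = g y
        simp [g, h, Setoid.refl' r y]
  have hr : Set.range g = {(⟦y⟧ : Quotient r)}ᶜ := by
    ext q
    simp only [Set.mem_range, Set.mem_compl_iff, Set.mem_singleton_iff]
    constructor
    · rintro ⟨a, rfl⟩ e
      by_cases ha : r a y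
      · simp only [g, ha, if_true] at e
        exact h (Quotient.exact e)
      · simp only [g, ha, if_false] at e
        exact ha (Quotient.exact e)
    · induction q using Quotient.inductionOn with
      | _ a =>
        intro hne
        have ha : ¬ r a y := fun h => hne (Quotient.sound h)
        exact ⟨a, by simp [g, ha]⟩
  rw [gdN, ← hg, Nat.card_congr (Setoid.quotientKerEquivRange g), hr]
  have := Set.ncard_add_ncard_compl ({(⟦y⟧ : Quotient r)} : Set (Quotient r))
  rw [Set.ncard_singleton] at this
  rw [Nat.card_coe_set_eq, gdN]
  omega

/-- same-cycle setoid -/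
def gdS {α : Type*} (f : Equiv.Perm α) : Setoid α := Equiv.Perm.SameCycle.setoid f

theorem gdS_le {α : Type*} {f : Equiv.Perm α} {r : Setoid α} : gdS f ≤ r ↔ ∀ a, r a (f a) := by
  constructor
  · intro h a
    exact h (show f.SameCycle a (f a) from ⟨1, by simp⟩)
  · rintro h a b ⟨k, rfl⟩
    induction k using Int.induction_on with
    | zero => simpa using Setoid.refl' r a
    | succ n ih =>
      rw [add_comm, zpow_add, zpow_one]
      exact Setoid.trans' _ ih (h _)
    | pred n ih =>
      refine Setoid.trans' _ ih (Setoid.symm' _ ?_)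
      have := h ((f ^ (-(n:ℤ) - 1)) a)
      rwa [← Equiv.Perm.mul_apply, ← zpow_one_add, add_sub_cancel] at this

open Equiv

theorem gdS_apply {α : Type*} (f : Perm α) (a : α) : gdS f a (f a) := gdS_le.1 le_rfl a

theorem gd_swap_rel {α : Type*} [DecidableEq α] (x y a : α) : gdPair x y a (swap x y a) := by
  have h : gdPair x y x y := gdPair_le.1 le_rfl
  by_cases hx : a = x
  · subst hx; simpa using h
  by_cases hy : a = y
  · subst hy; rw [swap_apply_right]; exact Setoid.symm' _ h
  rw [swap_apply_of_ne_of_ne hx hy]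

theorem gdS_swap_le {α : Type*} [DecidableEq α] (x y : α) (f : Perm α) :
    gdS (swap x y * f) ≤ gdS f ⊔ gdPair x y := by
  rw [gdS_le]
  intro a
  have h1 : (gdS f ⊔ gdPair x y) a (f a) :=
    (le_sup_left : gdS f ≤ gdS f ⊔ gdPair x y) (gdS_apply f a)
  have h2 : (gdS f ⊔ gdPair x y) (f a) (swap x y (f a)) :=
    (le_sup_right : gdPair x y ≤ gdS f ⊔ gdPair x y) (gd_swap_rel x y (f a))
  exact Setoid.trans' _ h1 h2

theorem gdS_swap_sup {α : Type*} [DecidableEq α] (x y : α) (f : Perm α) :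
    gdS (swap x y * f) ⊔ gdPair x y = gdS f ⊔ gdPair x y := by
  apply le_antisymm
  · exact sup_le (gdS_swap_le x y f) le_sup_right
  · refine sup_le ?_ le_sup_right
    have := gdS_swap_le x y (swap x y * f)
    rwa [← mul_assoc, swap_mul_self, one_mul] at this

theorem gdS_fix {α : Type*} [DecidableEq α] {x y : α} {f : Perm α} (hxy : x ≠ y) (hx : f x = x) :
    ¬ gdS f x y ∧ gdS (swap x y * f) = gdS f ⊔ gdPair x y := by
  constructor
  · rintro ⟨k, hk⟩
    rw [Perm.zpow_apply_eq_self_of_apply_eq_self hx] at hk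
    exact hxy hk
  · rw [← gdS_swap_sup, eq_comm, sup_eq_left, gdPair_le]
    have := gdS_apply (swap x y * f) x
    simpa [hx] using this

theorem gdN_one {α : Type*} [Fintype α] : gdN (gdS (1 : Perm α)) = Nat.card α := by
  have : gdS (1 : Perm α) = ⊥ := by
    rw [eq_bot_iff, gdS_le]
    intro a
    exact Setoid.refl' _ _
  rw [this]
  refine (Nat.card_congr (Equiv.ofBijective (Quotient.mk (⊥ : Setoid α)) ⟨?_, ?_⟩)).symm
  · intro a b h
    exact Quotient.exact h
  · exact Quotient.exists_rep

theorem gd_sign {α : Type*} [Fintype α] [DecidableEq α] (f : Perm α) :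
    Perm.sign f = (-1) ^ (Nat.card α + gdN (gdS f)) := by
  induction f using gd_perm_ind with
  | h1 => rw [gdN_one, Perm.sign_one, Even.neg_one_pow ⟨_, rfl⟩]
  | h2 f x y hxy hx ih =>
    obtain ⟨h1, h2⟩ := gdS_fix hxy hx
    have h3 := gdN_pair_not h1
    rw [Perm.sign_mul, Perm.sign_swap hxy, ih, h2, ← h3, ← add_assoc, pow_succ]
    simp

theorem gd_parity {α : Type*} [Fintype α] [DecidableEq α] (f : Perm α) {x y : α} (hxy : x ≠ y) :
    gdN (gdS (swap x y * f)) % 2 ≠ gdN (gdS f) % 2 := by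
  intro h
  have h1 := gd_sign (swap x y * f)
  rw [Perm.sign_mul, Perm.sign_swap hxy, gd_sign f] at h1
  have h2 : (-1 : ℤˣ) ^ (Nat.card α + gdN (gdS (swap x y * f)))
      = (-1) ^ (Nat.card α + gdN (gdS f)) := by
    have e : ∀ a b : ℕ, a % 2 = b % 2 → (-1 : ℤˣ) ^ a = (-1) ^ b := by
      intro a b hab
      rcases Nat.even_or_odd a with ha | ha
      · have hb : Even b := by rw [Nat.even_iff] at *; omega
        rw [ha.neg_one_pow, hb.neg_one_pow]
      · have hb : Odd b := by rw [Nat.odd_iff] at *; omega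
        rw [ha.neg_one_pow, hb.neg_one_pow]
    rw [pow_add, pow_add, e _ _ h]
  rw [h2] at h1
  simp at h1

theorem gd_main {α : Type*} [Fintype α] [DecidableEq α] (σ τ : Perm α) :
    ∃ d : ℕ, Nat.card α + 2 * gdN (gdS σ ⊔ gdS τ) =
      2 * d + gdN (gdS σ) + gdN (gdS τ) + gdN (gdS (σ * τ)) := by
  induction σ using gd_perm_ind with
  | h1 =>
    refine ⟨0, ?_⟩
    have : gdS (1 : Perm α) ⊔ gdS τ = gdS τ := by
      rw [sup_eq_right, gdS_le]
      intro a
      exact Setoid.refl' _ _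
    rw [this, gdN_one, one_mul]; ring
  | h2 σ x y hxy hx ih =>
    obtain ⟨d, hd⟩ := ih
    obtain ⟨h1, h2⟩ := gdS_fix hxy hx
    have h3 := gdN_pair_not h1
    rw [← h2] at h3
    have hK : gdS (swap x y * σ) ⊔ gdS τ = (gdS σ ⊔ gdS τ) ⊔ gdPair x y := by
      rw [h2, sup_right_comm]
    rw [hK, mul_assoc]
    have hle : gdS (σ * τ) ≤ gdS σ ⊔ gdS τ := by
      rw [gdS_le]
      intro a
      have e1 : (gdS σ ⊔ gdS τ) a (τ a) :=
        (le_sup_right : gdS τ ≤ gdS σ ⊔ gdS τ) (gdS_apply τ a)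
      have e2 : (gdS σ ⊔ gdS τ) (τ a) (σ (τ a)) :=
        (le_sup_left : gdS σ ≤ gdS σ ⊔ gdS τ) (gdS_apply σ _)
      exact Setoid.trans' _ e1 e2
    have hp := gd_parity (σ * τ) hxy
    have hs := congrArg gdN (gdS_swap_sup x y (σ * τ))
    have hnew : gdN (gdS (swap x y * (σ * τ)) ⊔ gdPair x y) = gdN (gdS (swap x y * (σ * τ))) ∨
        gdN (gdS (swap x y * (σ * τ)) ⊔ gdPair x y) + 1 = gdN (gdS (swap x y * (σ * τ))) := by
      by_cases h : gdS (swap x y * (σ * τ)) x y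
      · exact Or.inl (gdN_pair_of h)
      · exact Or.inr (gdN_pair_not h)
    by_cases hk : (gdS σ ⊔ gdS τ) x y
    · have h4 := gdN_pair_of hk
      have hold : gdN (gdS (σ * τ) ⊔ gdPair x y) = gdN (gdS (σ * τ)) ∨
          gdN (gdS (σ * τ) ⊔ gdPair x y) + 1 = gdN (gdS (σ * τ)) := by
        by_cases h : gdS (σ * τ) x y
        · exact Or.inl (gdN_pair_of h)
        · exact Or.inr (gdN_pair_not h)
      by_cases hc : gdN (gdS (swap x y * (σ * τ))) < gdN (gdS (σ * τ))
      · exact ⟨d + 1, by omega⟩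
      · exact ⟨d, by omega⟩
    · have h4 := gdN_pair_not hk
      have h5 := gdN_pair_not (fun h => hk (hle h))
      exact ⟨d, by omega⟩

theorem gd_count {I : Type*} [Fintype I] (σ : Perm I) (rep : I → I)
    (hrep : ∀ i, rep (σ i) = rep i) (hrep' : ∀ i, σ.SameCycle (rep i) i)
    (c : Set I) (h : ∀ i, σ i ∈ c ↔ i ∈ c) :
    gdN (gdS (σ.subtypePerm h : Perm {i // i ∈ c})) = (c ∩ {i | rep i = i}).ncard := by
  have hle : gdS σ ≤ Setoid.ker rep := gdS_le.2 fun a => (hrep a).symm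
  have hmem : ∀ i, rep i ∈ c ↔ i ∈ c := by
    intro i
    let r : Setoid I := Setoid.ker (fun j => j ∈ c)
    have : gdS σ ≤ r := gdS_le.2 fun a => propext (h a).symm
    have h2 : r (rep i) i := this (hrep' i)
    exact iff_of_eq h2
  rw [gdN, ← Nat.card_coe_set_eq, eq_comm]
  refine Nat.card_congr (Equiv.ofBijective
    (fun i : ↥(c ∩ {i | rep i = i}) => (⟦⟨i.1, i.2.1⟩⟧ : Quotient (gdS (σ.subtypePerm h : Perm {i // i ∈ c})))) ⟨?_, ?_⟩)
  · rintro ⟨i, hi, hi'⟩ ⟨j, hj, hj'⟩ e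
    have e' : (σ.subtypePerm h).SameCycle ⟨i, hi⟩ ⟨j, hj⟩ := Quotient.exact e
    rw [Perm.sameCycle_subtypePerm] at e'
    have e2 : rep i = rep j := hle e'
    have hi2 : rep i = i := hi'
    have hj2 : rep j = j := hj'
    exact Subtype.ext (hi2.symm.trans (e2.trans hj2))
  · intro q
    induction q using Quotient.inductionOn with
    | _ a =>
      refine ⟨⟨rep a.1, (hmem _).2 a.2, ?_⟩, ?_⟩
      · exact hle (hrep' a.1)
      · apply Quotient.sound
        change (σ.subtypePerm h).SameCycle _ _
        rw [Perm.sameCycle_subtypePerm]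
        exact hrep' a.1

/-!
STATEMENT 6: For permutations `σ, τ` of a finite set `I` and an orbit `c` of
`⟨σ, τ⟩` on `I`, the graph defect
`gd(σ,τ)_c = (1/2)(|c| + 2 − |c/⟨σ⟩| − |c/⟨τ⟩| − |c/⟨στ⟩|)`
is a non-negative integer, i.e. there is `d : ℕ` with
`|c| + 2 = 2d + |c/⟨σ⟩| + |c/⟨τ⟩| + |c/⟨στ⟩|`.
Orbits of `⟨σ⟩` etc. inside `c` are counted through a choice of orbit
representatives (`repσ i` is the representative of the `σ`-orbit of `i`, etc.).
-/
theorem stmt6 {I : Type*} [Fintype I] [DecidableEq I]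
    (σ τ : Equiv.Perm I)
    (repσ repτ repστ : I → I)
    (hrepσ : ∀ i, repσ (σ i) = repσ i) (hrepσ' : ∀ i, σ.SameCycle (repσ i) i)
    (hrepτ : ∀ i, repτ (τ i) = repτ i) (hrepτ' : ∀ i, τ.SameCycle (repτ i) i)
    (hrepστ : ∀ i, repστ ((σ * τ) i) = repστ i)
    (hrepστ' : ∀ i, (σ * τ).SameCycle (repστ i) i)
    (c : Set I) (i₀ : I)
    (hc : c = {j | ∃ p ∈ Subgroup.closure ({σ, τ} : Set (Equiv.Perm I)), p i₀ = j}) :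
    ∃ d : ℕ, (c.ncard : ℤ) + 2 =
      2 * d + (c ∩ {i | repσ i = i}).ncard + (c ∩ {i | repτ i = i}).ncard
        + (c ∩ {i | repστ i = i}).ncard := by
  let G := Subgroup.closure ({σ, τ} : Set (Equiv.Perm I))
  have hσG : σ ∈ G := Subgroup.subset_closure (by simp)
  have hτG : τ ∈ G := Subgroup.subset_closure (by simp)
  have hinv : ∀ g ∈ G, ∀ i, g i ∈ c ↔ i ∈ c := by
    intro g hg i
    rw [hc]
    constructor
    · rintro ⟨p, hp, e⟩
      exact ⟨g⁻¹ * p, G.mul_mem (G.inv_mem hg) hp, by simp [e]⟩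
    · rintro ⟨p, hp, e⟩
      exact ⟨g * p, G.mul_mem hg hp, by simp [e]⟩
  have hσ := hinv σ hσG
  have hτ := hinv τ hτG
  have hστ := hinv (σ * τ) (G.mul_mem hσG hτG)
  have h0 : i₀ ∈ c := by rw [hc]; exact ⟨1, G.one_mem, rfl⟩
  classical
  haveI : Fintype {i // i ∈ c} := Fintype.ofFinite _
  obtain ⟨d, hd⟩ := gd_main (σ.subtypePerm hσ : Equiv.Perm {i // i ∈ c}) (τ.subtypePerm hτ)
  have hmul : (σ.subtypePerm hσ : Equiv.Perm {i // i ∈ c}) * (τ.subtypePerm hτ)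
      = (σ * τ).subtypePerm hστ := by
    ext a; rfl
  rw [hmul, gd_count σ repσ hrepσ hrepσ', gd_count τ repτ hrepτ hrepτ',
    gd_count (σ * τ) repστ hrepστ hrepστ'] at hd
  have hcard : Nat.card {i // i ∈ c} = c.ncard := Nat.card_coe_set_eq c
  have hk : gdN (gdS (σ.subtypePerm hσ : Equiv.Perm {i // i ∈ c}) ⊔ gdS (τ.subtypePerm hτ)) = 1 := by
    set r := gdS (σ.subtypePerm hσ : Equiv.Perm {i // i ∈ c}) ⊔ gdS (τ.subtypePerm hτ) with hr
    have hrσ : ∀ a, r a (σ.subtypePerm hσ a) := gdS_le.1 le_sup_left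
    have hrτ : ∀ a, r a (τ.subtypePerm hτ a) := gdS_le.1 le_sup_right
    have key : ∀ g (hg : g ∈ G), ∀ a : {i // i ∈ c}, r a ⟨g a.1, (hinv g hg a.1).2 a.2⟩ := by
      intro g hg
      induction hg using Subgroup.closure_induction with
      | mem g hg =>
        intro a
        rcases hg with rfl | rfl
        · exact hrσ a
        · exact hrτ a
      | one => intro a; exact Setoid.refl' _ _
      | mul g g' hg hg' ih ih' =>
        intro a
        exact Setoid.trans' _ (ih' a) (ih _)
      | inv g hg ih =>
        intro a
        have := ih ⟨g⁻¹ a.1, (hinv _ (G.inv_mem hg) a.1).2 a.2⟩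
        have e : (⟨g (g⁻¹ a.1), (hinv g hg _).2 ((hinv _ (G.inv_mem hg) a.1).2 a.2)⟩ :
            {i // i ∈ c}) = a := Subtype.ext (by simp)
        rw [e] at this
        exact Setoid.symm' _ this
    rw [gdN, Nat.card_eq_one_iff_unique]
    refine ⟨⟨?_⟩, ⟨⟦⟨i₀, h0⟩⟧⟩⟩
    have hall : ∀ q : Quotient r, q = ⟦⟨i₀, h0⟩⟧ := by
      intro q
      induction q using Quotient.inductionOn with
      | _ a =>
        obtain ⟨a, ha⟩ := a
        have ha' := ha
        rw [hc] at ha'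
        obtain ⟨p, hp, rfl⟩ := ha'
        exact Quotient.sound (Setoid.symm' _ (key p hp ⟨i₀, h0⟩))
    intro a b
    rw [hall a, hall b]
  rw [hk, hcard] at hd
  exact ⟨d, by exact_mod_cast hd⟩
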